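/- Restriction to signalings supported on Ξ̂ is without loss for the leader (Lemma 1): for every consistent signaling π ∈ Π there exists a consistent signaling π̂ ∈ Π̂ (supported on the finite set Ξ̂) such that U π̂ θ̂ θ = U π θ̂ θ for all θ̂, θ : Fin K, and V π̂ θ̂ θ ≥ V π θ̂ θ for all θ̂, θ : Fin K; consequently ψ θ π̂ = ψ θ π for every θ and V^μ π̂ ≥ V^μ π. -/

import Mathlib

open Finset Set

attribute [local instance] Classical.propDecidable

noncomputable section

variable {M N K : ℕ}

/-- The belief space `Ξ` is the standard simplex; the best-response region `Ξ[θ,j]` consists of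
the beliefs under which `j` is a best response for the type-`θ` follower. -/
def XiBR (F : Fin K → Fin M → Fin N → ℝ) (θ : Fin K) (j : Fin N) : Set (Fin M → ℝ) :=
  {b | b ∈ stdSimplex ℝ (Fin M) ∧ ∀ j' : Fin N, ∑ i, b i * F θ i j' ≤ ∑ i, b i * F θ i j}

/-- The region `Ξ[𝐣] = ⋂ θ, Ξ[θ, 𝐣 θ]`. -/
def XiT (F : Fin K → Fin M → Fin N → ℝ) (js : Fin K → Fin N) : Set (Fin M → ℝ) :=
  ⋂ θ : Fin K, XiBR F θ (js θ)

/-- The follower's value function `F̄ θ b = max_j ∑ i, b i * F θ i j`. -/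
def Fbar (F : Fin K → Fin M → Fin N → ℝ) (θ : Fin K) (b : Fin M → ℝ) : ℝ :=
  ⨆ j : Fin N, ∑ i, b i * F θ i j

/-- The leader's (leader-favored tie-broken) value function `V̄ θ b`: the maximum of
`∑ i, b i * L i j` over the follower best responses `j` at belief `b`. -/
def Vbar (L : Fin M → Fin N → ℝ) (F : Fin K → Fin M → Fin N → ℝ) (θ : Fin K)
    (b : Fin M → ℝ) : ℝ :=
  sSup ((fun j => ∑ i, b i * L i j) '' {j : Fin N | ∑ i, b i * F θ i j = Fbar F θ b})

/-- The set of beliefs `Ξ̂`: the union over tuples `𝐣` of the extreme points of `Ξ[𝐣]`. -/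
def XiHat (F : Fin K → Fin M → Fin N → ℝ) : Set (Fin M → ℝ) :=
  ⋃ js : Fin K → Fin N, Set.extremePoints ℝ (XiT F js)

/-- A signaling assigns to each type a nonnegative finitely supported weight function on
beliefs, supported in the simplex, of total mass one. -/
def IsSignaling (π : Fin K → ((Fin M → ℝ) →₀ ℝ)) : Prop :=
  ∀ θ : Fin K, (∀ b, 0 ≤ π θ b) ∧ (((π θ).support : Set (Fin M → ℝ)) ⊆ stdSimplex ℝ (Fin M)) ∧
    ∑ b ∈ (π θ).support, π θ b = 1

/-- Consistency: all types' expected posterior beliefs coincide. -/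
def Consistent (π : Fin K → ((Fin M → ℝ) →₀ ℝ)) : Prop :=
  ∀ θ θ' : Fin K, ∀ i : Fin M,
    ∑ b ∈ (π θ).support, π θ b * b i = ∑ b ∈ (π θ').support, π θ' b * b i

/-- The set `Π` of consistent signalings. -/
def SigSet (M K : ℕ) : Set (Fin K → ((Fin M → ℝ) →₀ ℝ)) :=
  {π | IsSignaling π ∧ Consistent π}

/-- The set `Π̂` of consistent signalings supported on `Ξ̂`. -/
def SigSetHat (F : Fin K → Fin M → Fin N → ℝ) : Set (Fin K → ((Fin M → ℝ) →₀ ℝ)) :=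
  {π | π ∈ SigSet M K ∧ ∀ θ, ((π θ).support : Set (Fin M → ℝ)) ⊆ XiHat F}

/-- The follower's expected utility `U π θ̂ θ`. -/
def Usig (F : Fin K → Fin M → Fin N → ℝ) (π : Fin K → ((Fin M → ℝ) →₀ ℝ))
    (θhat θ : Fin K) : ℝ :=
  ∑ b ∈ (π θhat).support, π θhat b * Fbar F θ b

/-- The leader's expected utility `V π θ̂ θ`. -/
def Vsig (L : Fin M → Fin N → ℝ) (F : Fin K → Fin M → Fin N → ℝ)
    (π : Fin K → ((Fin M → ℝ) →₀ ℝ)) (θhat θ : Fin K) : ℝ :=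
  ∑ b ∈ (π θhat).support, π θhat b * Vbar L F θ b

/-- The follower's optimal reporting strategy `ψ θ π`: the least maximizer of `U π · θ`. -/
def psi (F : Fin K → Fin M → Fin N → ℝ) (π : Fin K → ((Fin M → ℝ) →₀ ℝ)) (θ : Fin K) :
    Fin K :=
  if h : (Finset.univ.filter fun θhat => ∀ β, Usig F π β θ ≤ Usig F π θhat θ).Nonempty then
    (Finset.univ.filter fun θhat => ∀ β, Usig F π β θ ≤ Usig F π θhat θ).min' h
  else θ

/-- The leader's expected utility `V^μ` under prior `μ`. -/
def Vmu (L : Fin M → Fin N → ℝ) (F : Fin K → Fin M → Fin N → ℝ) (μ : Fin K → ℝ)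
    (π : Fin K → ((Fin M → ℝ) →₀ ℝ)) : ℝ :=
  ∑ θ, μ θ * Vsig L F π (psi F π θ) θ

/-- A polyhedron cut out by finitely many linear inequalities has finitely many extreme points:
an extreme point is determined by the constraints that are active at it. -/
theorem finite_extremePoints_polyhedron {E ι : Type*} [AddCommGroup E] [Module ℝ E] [Finite ι]
    (f : ι → E →ₗ[ℝ] ℝ) (c : ι → ℝ) :
    (Set.extremePoints ℝ {x | ∀ i, f i x ≤ c i}).Finite := by
  refine Set.Finite.of_injOn (f := fun x => {i | f i x = c i}) (t := Set.univ)
    (fun _ _ => Set.mem_univ _) ?_ Set.finite_univ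
  intro x hx y hy hxy
  have hactive : ∀ i, f i x = c i → f i y = c i := fun i hi => by
    have h : i ∈ {i | f i x = c i} := hi
    rw [show {i | f i x = c i} = {i | f i y = c i} from hxy] at h
    exact h
  have hpush : ∀ᶠ ε : ℝ in nhdsWithin 0 (Set.Ioi 0), ∀ i, f i x - ε * (f i y - f i x) ≤ c i := by
    refine Filter.eventually_all.2 fun i => ?_
    rcases (hx.1 i).eq_or_lt with h | h
    · simp [hactive i h, h]
    · have hcont : Filter.Tendsto (fun ε : ℝ => f i x - ε * (f i y - f i x))
          (nhdsWithin 0 (Set.Ioi 0)) (nhds (f i x)) := by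
        have : Continuous fun ε : ℝ => f i x - ε * (f i y - f i x) := by fun_prop
        simpa using (this.tendsto 0).mono_left nhdsWithin_le_nhds
      exact (hcont.eventually_lt_const h).mono fun _ => le_of_lt
  obtain ⟨ε, hε, hε0⟩ := (hpush.and self_mem_nhdsWithin).exists
  have hε0 : 0 < ε := hε0
  have hz : x - ε • (y - x) ∈ {x | ∀ i, f i x ≤ c i} := fun i => by simpa using hε i
  refine ((mem_extremePoints_iff_left.1 hx).2 y hy.1 _ hz
    ⟨ε / (1 + ε), 1 / (1 + ε), by positivity, by positivity, by field_simp; ring, ?_⟩).symm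
  match_scalars <;> field_simp <;> ring

/-- The constraints cutting out the region `Ξ[𝐣]`: nonnegativity, total mass one, and optimality
of `𝐣 θ` for each type `θ`. -/
theorem finite_extremePoints_XiT [Nonempty (Fin K)] (F : Fin K → Fin M → Fin N → ℝ)
    (js : Fin K → Fin N) : (Set.extremePoints ℝ (XiT F js)).Finite := by
  let pairing (v : Fin M → ℝ) : (Fin M → ℝ) →ₗ[ℝ] ℝ := ∑ i, v i • LinearMap.proj i
  have hpairing : ∀ v b, pairing v b = ∑ i, b i * v i := fun v b => by
    simp [pairing, mul_comm]
  let f : Fin M ⊕ Bool ⊕ Fin K × Fin N → (Fin M → ℝ) →ₗ[ℝ] ℝ :=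
    Sum.elim (fun i => -LinearMap.proj i) (Sum.elim
      (fun s => bif s then pairing 1 else -pairing 1)
      (fun p => pairing (fun i => F p.1 i p.2) - pairing (fun i => F p.1 i (js p.1))))
  let c : Fin M ⊕ Bool ⊕ Fin K × Fin N → ℝ :=
    Sum.elim 0 (Sum.elim (fun s => bif s then 1 else -1) 0)
  have hXiT : XiT F js = {x | ∀ i, f i x ≤ c i} := by
    ext b
    simp only [XiT, XiBR, Set.mem_iInter, Set.mem_ofPred_eq, stdSimplex]
    simp only [f, c, hpairing, forall_and, le_antisymm_iff, and_assoc, Sum.forall, Bool.forall_bool,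
      Prod.forall, forall_const, Sum.elim_inl, Sum.elim_inr, cond_true, cond_false,
      LinearMap.neg_apply, LinearMap.sub_apply, LinearMap.proj_apply, Pi.zero_apply, Pi.one_apply,
      mul_one, neg_le_neg_iff, Left.neg_nonpos_iff, sub_nonpos]
    tauto
  rw [hXiT]
  exact finite_extremePoints_polyhedron f c

theorem isCompact_XiT [Nonempty (Fin K)] (F : Fin K → Fin M → Fin N → ℝ) (js : Fin K → Fin N) :
    IsCompact (XiT F js) := by
  refine (isCompact_stdSimplex ℝ (Fin M)).of_isClosed_subset (isClosed_iInter fun θ => ?_)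
    fun b hb => (Set.mem_iInter.1 hb (Classical.arbitrary _)).1
  refine (isClosed_stdSimplex ℝ (Fin M)).inter
    (s₂ := {b | ∀ j', ∑ i, b i * F θ i j' ≤ ∑ i, b i * F θ i (js θ)}) ?_
  rw [Set.ofPred_forall]
  exact isClosed_iInter fun j' => isClosed_le (by fun_prop) (by fun_prop)

theorem convex_XiT (F : Fin K → Fin M → Fin N → ℝ) (js : Fin K → Fin N) :
    Convex ℝ (XiT F js) := by
  refine convex_iInter fun θ => (convex_stdSimplex ℝ (Fin M)).inter ?_
  intro x hx y hy a b ha hb _ j'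
  have hx := mul_le_mul_of_nonneg_left (hx j') ha
  have hy := mul_le_mul_of_nonneg_left (hy j') hb
  simp only [Finset.mul_sum] at hx hy
  simp only [Pi.add_apply, Pi.smul_apply, smul_eq_mul, add_mul, Finset.sum_add_distrib, mul_assoc]
  exact add_le_add hx hy

/-- A point of a convex hull is the barycenter of a finitely supported probability weight. -/
theorem exists_finsupp_of_mem_convexHull {E : Type*} [AddCommGroup E] [Module ℝ E] {s : Set E}
    {x : E} (hx : x ∈ convexHull ℝ s) :
    ∃ w : E →₀ ℝ, (∀ y, 0 ≤ w y) ∧ (w.support : Set E) ⊆ s ∧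
      Finsupp.linearCombination ℝ (fun _ => (1 : ℝ)) w = 1 ∧
      Finsupp.linearCombination ℝ id w = x := by
  refine convexHull_min (t := {x | ∃ w : E →₀ ℝ, (∀ y, 0 ≤ w y) ∧ (w.support : Set E) ⊆ s ∧
      Finsupp.linearCombination ℝ (fun _ => (1 : ℝ)) w = 1 ∧
      Finsupp.linearCombination ℝ id w = x}) ?_ ?_ hx
  · intro y hy
    refine ⟨Finsupp.single y 1, fun z => ?_, ?_, by simp, by simp⟩
    · rw [Finsupp.single_apply]
      split_ifs <;> norm_num
    · simpa [Finsupp.support_single] using hy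
  · rintro _ ⟨w, hw0, hws, hw1, rfl⟩ _ ⟨v, hv0, hvs, hv1, rfl⟩ a b ha hb hab
    refine ⟨a • w + b • v, fun y => ?_, fun y hy => ?_, by simp [hw1, hv1, hab], by simp⟩
    · exact add_nonneg (mul_nonneg ha (hw0 y)) (mul_nonneg hb (hv0 y))
    · by_contra hys
      have hwy : w y = 0 := Finsupp.notMem_support_iff.1 fun h => hys (hws h)
      have hvy : v y = 0 := Finsupp.notMem_support_iff.1 fun h => hys (hvs h)
      simp [hwy, hvy] at hy

theorem Fbar_eq_of_mem_XiBR {F : Fin K → Fin M → Fin N → ℝ} {θ : Fin K} {j : Fin N}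
    {b : Fin M → ℝ} (hb : b ∈ XiBR F θ j) : Fbar F θ b = ∑ i, b i * F θ i j := by
  have : Nonempty (Fin N) := ⟨j⟩
  exact le_antisymm (ciSup_le hb.2)
    (le_ciSup (f := fun j => ∑ i, b i * F θ i j) (Set.finite_range _).bddAbove j)

theorem le_Vbar_of_mem_XiBR (L : Fin M → Fin N → ℝ) {F : Fin K → Fin M → Fin N → ℝ} {θ : Fin K}
    {j : Fin N} {b : Fin M → ℝ} (hb : b ∈ XiBR F θ j) : ∑ i, b i * L i j ≤ Vbar L F θ b :=
  le_csSup ((Set.toFinite _).image _).bddAbove ⟨j, (Fbar_eq_of_mem_XiBR hb).symm, rfl⟩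

theorem exists_mem_XiBR_Vbar_eq [Nonempty (Fin N)] (L : Fin M → Fin N → ℝ)
    (F : Fin K → Fin M → Fin N → ℝ) (θ : Fin K) {b : Fin M → ℝ} (hb : b ∈ stdSimplex ℝ (Fin M)) :
    ∃ j, b ∈ XiBR F θ j ∧ Vbar L F θ b = ∑ i, b i * L i j := by
  have hne : {j : Fin N | ∑ i, b i * F θ i j = Fbar F θ b}.Nonempty :=
    exists_eq_ciSup_of_finite (f := fun j => ∑ i, b i * F θ i j)
  obtain ⟨j, hj, hjV⟩ := (hne.image fun j => ∑ i, b i * L i j).csSup_mem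
    ((Set.toFinite _).image _)
  refine ⟨j, ⟨hb, fun j' => ?_⟩, hjV.symm⟩
  rw [show ∑ i, b i * F θ i j = Fbar F θ b from hj]
  exact le_ciSup (f := fun j => ∑ i, b i * F θ i j) (Set.finite_range _).bddAbove j'

/-- Every belief splits into extreme points of a region `Ξ[𝐣]` without changing any follower
value and without lowering any leader value. -/
theorem exists_splitting [Nonempty (Fin K)] [Nonempty (Fin N)] (L : Fin M → Fin N → ℝ)
    (F : Fin K → Fin M → Fin N → ℝ) {b : Fin M → ℝ} (hb : b ∈ stdSimplex ℝ (Fin M)) :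
    ∃ w : (Fin M → ℝ) →₀ ℝ, (∀ y, 0 ≤ w y) ∧ (w.support : Set (Fin M → ℝ)) ⊆ XiHat F ∧
      Finsupp.linearCombination ℝ (fun _ => (1 : ℝ)) w = 1 ∧
      Finsupp.linearCombination ℝ id w = b ∧
      (∀ θ, Finsupp.linearCombination ℝ (Fbar F θ) w = Fbar F θ b) ∧
      ∀ θ, Vbar L F θ b ≤ Finsupp.linearCombination ℝ (Vbar L F θ) w := by
  choose js hjs hjsV using fun θ => exists_mem_XiBR_Vbar_eq L F θ hb
  have hull : b ∈ convexHull ℝ (Set.extremePoints ℝ (XiT F js)) := by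
    rw [← ((finite_extremePoints_XiT F js).isClosed_convexHull ℝ).closure_eq,
      closure_convexHull_extremePoints (isCompact_XiT F js) (convex_XiT F js)]
    exact Set.mem_iInter.2 hjs
  obtain ⟨w, hw0, hws, hw1, hwb⟩ := exists_finsupp_of_mem_convexHull hull
  have hmem : ∀ y ∈ w.support, ∀ θ, y ∈ XiBR F θ (js θ) := fun y hy =>
    Set.mem_iInter.1 (hws hy).1
  have hlin : ∀ v : Fin M → ℝ,
      ∑ y ∈ w.support, w y * ∑ i, y i * v i = ∑ i, b i * v i := fun v => by
    simp_rw [← hwb, Finsupp.linearCombination_apply, Finsupp.sum, Finset.sum_apply,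
      Finset.mul_sum, Finset.sum_mul]
    rw [Finset.sum_comm]
    simp [mul_assoc]
  refine ⟨w, hw0, hws.trans (Set.subset_iUnion_of_subset js subset_rfl), hw1, hwb,
    fun θ => ?_, fun θ => ?_⟩
  · rw [Fbar_eq_of_mem_XiBR (hjs θ), ← hlin]
    exact Finset.sum_congr rfl fun y hy =>
      congrArg (w y * ·) (Fbar_eq_of_mem_XiBR (hmem y hy θ))
  · rw [hjsV θ, ← hlin]
    exact Finset.sum_le_sum fun y hy =>
      mul_le_mul_of_nonneg_left (le_Vbar_of_mem_XiBR L (hmem y hy θ)) (hw0 y)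

theorem XiHat_subset_stdSimplex [Nonempty (Fin K)] (F : Fin K → Fin M → Fin N → ℝ) :
    XiHat F ⊆ stdSimplex ℝ (Fin M) :=
  Set.iUnion_subset fun _ _ hb => (Set.mem_iInter.1 hb.1 (Classical.arbitrary _)).1

theorem psi_congr {F : Fin K → Fin M → Fin N → ℝ} {π π' : Fin K → ((Fin M → ℝ) →₀ ℝ)}
    (h : Usig F π = Usig F π') : psi F π = psi F π' := by
  funext θ
  unfold psi
  rw [h]

/-- Lemma 1: restriction to signalings supported on `Ξ̂` is without loss for
the leader. -/
theorem restriction_to_xiHat_wlog (M N K : ℕ) (hM : 0 < M) (hN : 0 < N) (hK : 0 < K)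
    (L : Fin M → Fin N → ℝ) (F : Fin K → Fin M → Fin N → ℝ)
    (μ : Fin K → ℝ) (hμ0 : ∀ θ, 0 ≤ μ θ) (hμ1 : ∑ θ, μ θ = 1) :
    ∀ π ∈ SigSet M K, ∃ πh ∈ SigSetHat F,
      (∀ θhat θ : Fin K, Usig F πh θhat θ = Usig F π θhat θ) ∧
      (∀ θhat θ : Fin K, Vsig L F πh θhat θ ≥ Vsig L F π θhat θ) ∧
      (∀ θ : Fin K, psi F πh θ = psi F π θ) ∧
      Vmu L F μ πh ≥ Vmu L F μ π := by
  have : Nonempty (Fin N) := ⟨⟨0, hN⟩⟩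
  have : Nonempty (Fin K) := ⟨⟨0, hK⟩⟩
  rintro π ⟨hπ, hcons⟩
  choose! w hw0 hws hw1 hwb hwF hwV using
    fun (b : Fin M → ℝ) (hb : b ∈ stdSimplex ℝ (Fin M)) => exists_splitting L F hb
  let πh : Fin K → ((Fin M → ℝ) →₀ ℝ) := fun θ => Finsupp.linearCombination ℝ w (π θ)
  have hmem : ∀ θ, ∀ b ∈ (π θ).support, b ∈ stdSimplex ℝ (Fin M) := fun θ b hb => (hπ θ).2.1 hb
  have hexp : ∀ {V : Type} [AddCommGroup V] [Module ℝ V] (g : (Fin M → ℝ) → V) (θ : Fin K),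
      Finsupp.linearCombination ℝ g (πh θ) =
        ∑ b ∈ (π θ).support, π θ b • Finsupp.linearCombination ℝ g (w b) := by
    intro V _ _ g θ
    simp [πh, Finsupp.linearCombination_apply ℝ (v := w), Finsupp.sum]
  have hbary : ∀ θ, Finsupp.linearCombination ℝ id (πh θ) =
      Finsupp.linearCombination ℝ id (π θ) := fun θ => by
    rw [hexp]
    exact Finset.sum_congr rfl fun b hb => by rw [hwb b (hmem θ b hb)]; rfl
  have hsupp : ∀ θ, ((πh θ).support : Set (Fin M → ℝ)) ⊆ XiHat F := by
    intro θ y hy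
    by_contra hys
    refine Finsupp.mem_support_iff.1 hy ?_
    simp only [πh, Finsupp.linearCombination_apply, Finsupp.sum, Finsupp.finsetSum_apply,
      Finsupp.smul_apply]
    refine Finset.sum_eq_zero fun b hb => ?_
    rw [Finsupp.notMem_support_iff.1 fun h => hys (hws b (hmem θ b hb) h), smul_zero]
  have hmoment : ∀ (ρ : Fin K → ((Fin M → ℝ) →₀ ℝ)) (θ : Fin K) (i : Fin M),
      ∑ b ∈ (ρ θ).support, ρ θ b * b i = Finsupp.linearCombination ℝ id (ρ θ) i := fun ρ θ i => by
    simp [Finsupp.linearCombination_apply, Finsupp.sum]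
  have hU : ∀ θhat θ : Fin K, Usig F πh θhat θ = Usig F π θhat θ := fun θhat θ => by
    refine (hexp (Fbar F θ) θhat).trans (Finset.sum_congr rfl fun b hb => ?_)
    rw [hwF b (hmem θhat b hb), smul_eq_mul]
  have hV : ∀ θhat θ : Fin K, Vsig L F πh θhat θ ≥ Vsig L F π θhat θ := fun θhat θ =>
    (Finset.sum_le_sum fun b hb => mul_le_mul_of_nonneg_left (hwV b (hmem θhat b hb) θ)
      ((hπ θhat).1 b)).trans_eq (hexp (Vbar L F θ) θhat).symm
  have hpsi : psi F πh = psi F π := psi_congr (funext₂ hU)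
  refine ⟨πh, ⟨⟨fun θ => ⟨fun y => ?_, (hsupp θ).trans (XiHat_subset_stdSimplex F), ?_⟩,
    fun θ θ' i => ?_⟩, hsupp⟩, hU, hV, fun θ => congrFun hpsi θ, ?_⟩
  · simp only [πh, Finsupp.linearCombination_apply, Finsupp.sum, Finsupp.finsetSum_apply,
      Finsupp.smul_apply]
    exact Finset.sum_nonneg fun b hb => mul_nonneg ((hπ θ).1 b) (hw0 b (hmem θ b hb) y)
  · have h := hexp (fun _ => (1 : ℝ)) θ
    rw [Finset.sum_congr rfl fun b hb => by rw [hw1 b (hmem θ b hb)]] at h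
    simpa [Finsupp.linearCombination_apply, Finsupp.sum, (hπ θ).2.2] using h
  · rw [hmoment, hmoment, hbary, hbary, ← hmoment, ← hmoment, hcons θ θ' i]
  · unfold Vmu
    rw [hpsi]
    exact Finset.sum_le_sum fun θ _ => mul_le_mul_of_nonneg_left (hV _ θ) (hμ0 θ)

end
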